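/- Let G be an abelian group, S a finite subset of P_G, and F an algebraically closed field. Fix ε: S → F^×, identified with the homomorphism F_S → F^× it generates. For a finitely supported function m: S → ℕ, write X^m for the corresponding monomial in the polynomial ring F[x_i : i ∈ S], r(m) ∈ F_S for the corresponding product ∏_{i∈S} i^{m(i)}, and ε(m) := ∏_{i∈S} ε(i)^{m(i)}. Then a polynomial f ∈ F[x_i : i ∈ S] vanishes at every point (dα(g,h)·ε({g,h}))_{{g,h}∈S} with α: G → F^× arbitrary (equivalently, f lies in the vanishing ideal of the Zariski closure of this orbit in F^S) if and only if f lies in the F-linear span of the binomials ε(m₂)·X^{m₁} − ε(m₁)·X^{m₂} over all pairs of finitely supported functions m₁, m₂: S → ℕ with r(m₁)r(m₂)^{-1} ∈ ⟨R_G⟩ ∩ F_S. -/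

import Mathlib

/-!
STATEMENT 12: For a finite subset `S ⊆ P_G`, an algebraically closed field `F` and
`ε : S → F^×`, a polynomial `f ∈ F[x_i : i ∈ S]` vanishes at every point
`(dα(g,h)·ε({g,h}))_{{g,h} ∈ S}` (α : G → F^× arbitrary) if and only if `f` lies in the
`F`-linear span of the binomials `ε(m₂)·X^{m₁} − ε(m₁)·X^{m₂}` over all pairs of
finitely supported `m₁, m₂ : S → ℕ` with `r(m₁)r(m₂)⁻¹ ∈ ⟨R_G⟩ ∩ F_S`.
(`F_G` and its subgroups are written additively.)
-/

universe u v

open FreeAbelianGroup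

variable (G : Type u) [CommGroup G]

/-- The set of relators `{g,h}{gh,k}{h,k}⁻¹{g,hk}⁻¹` (written additively)
in the free abelian group `F_G` on the set of unordered pairs of elements of `G`. -/
def relatorSet : Set (FreeAbelianGroup (Sym2 G)) :=
  {r | ∃ g h k : G,
    r = of s(g, h) + of s(g * h, k) - of s(h, k) - of s(g, h * k)}

/-- The subgroup `⟨R_G⟩` of `F_G` generated by the relators. -/
def RG : AddSubgroup (FreeAbelianGroup (Sym2 G)) :=
  AddSubgroup.closure (relatorSet G)

variable {G}

/-- The subgroup `F_S` of `F_G` generated by `S ⊆ P_G`. -/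
def FS (S : Set (Sym2 G)) : AddSubgroup (FreeAbelianGroup (Sym2 G)) :=
  AddSubgroup.closure (of '' S)

/-- The element `r(m) = ∏_{i ∈ S} i^{m(i)}` of `F_S ⊆ F_G` (written additively)
associated with a finitely supported `m : S → ℕ`. -/
noncomputable def rOf (S : Set (Sym2 G)) (m : ↥S →₀ ℕ) : FreeAbelianGroup (Sym2 G) :=
  m.sum fun i n => n • of (↑i : Sym2 G)

variable (F : Type v) [Field F]

/-- The value of the coboundary `dα` at an unordered pair:
`dα({g,h}) = α(g)·α(h)·α(gh)⁻¹`. -/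
noncomputable def dal (α : G → Fˣ) : Sym2 G → F :=
  Sym2.lift ⟨fun g h => ((α g * α h * (α (g * h))⁻¹ : Fˣ) : F),
    fun g h => by dsimp only; rw [mul_comm h g, mul_comm (α h) (α g)]⟩

/-- `ε(m) = ∏_{i ∈ S} ε(i)^{m(i)} ∈ F`. -/
noncomputable def epow (S : Set (Sym2 G)) (ε : ↥S → Fˣ) (m : ↥S →₀ ℕ) : F :=
  m.prod fun i n => (ε i : F) ^ n

/-- The additive map `F_G → A` extending the coboundary `{g,h} ↦ β(g) + β(h) - β(gh)`. -/
noncomputable def coboundaryHom {A : Type*} [AddCommGroup A] (β : G → A) :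
    FreeAbelianGroup (Sym2 G) →+ A :=
  FreeAbelianGroup.lift (Sym2.lift ⟨fun g h => β g + β h - β (g * h),
    fun g h => by dsimp only; rw [mul_comm h g, add_comm (β h)]⟩)

@[simp]
theorem coboundaryHom_of {A : Type*} [AddCommGroup A] (β : G → A) (g h : G) :
    coboundaryHom β (of s(g, h)) = β g + β h - β (g * h) := by
  simp [coboundaryHom]

set_option linter.unusedSectionVars false in
theorem addMonoidHom_ext_sym2 {A : Type*} [AddCommGroup A]
    {φ ψ : FreeAbelianGroup (Sym2 G) →+ A}
    (H : ∀ g h : G, φ (of s(g, h)) = ψ (of s(g, h))) : φ = ψ :=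
  FreeAbelianGroup.lift_ext _ _ fun x => Sym2.ind H x

theorem coboundaryHom_add {A : Type*} [AddCommGroup A] (β γ : G → A) :
    coboundaryHom (β + γ) = coboundaryHom β + coboundaryHom γ :=
  addMonoidHom_ext_sym2 fun g h => by simp; abel

theorem coboundaryHom_comp {A B : Type*} [AddCommGroup A] [AddCommGroup B] (φ : A →+ B)
    (β : G → A) : coboundaryHom (φ ∘ β) = φ.comp (coboundaryHom β) :=
  addMonoidHom_ext_sym2 fun g h => by simp

theorem coboundaryHom_eq_lift_comp {A : Type*} [AddCommGroup A] (β : G → A) :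
    coboundaryHom β = (FreeAbelianGroup.lift β).comp (coboundaryHom of) := by
  rw [← coboundaryHom_comp]
  congr 1
  ext g
  simp

theorem coboundaryHom_eq_zero_of_mem {A : Type*} [AddCommGroup A] (β : G → A)
    {w : FreeAbelianGroup (Sym2 G)} (hw : w ∈ RG G) : coboundaryHom β w = 0 := by
  have : RG G ≤ (coboundaryHom β).ker := by
    rw [RG, AddSubgroup.closure_le]
    rintro _ ⟨g, h, k, rfl⟩
    simp only [SetLike.mem_coe, AddMonoidHom.mem_ker, map_sub, map_add, coboundaryHom_of, mul_assoc]
    abel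
  exact this hw

variable (G) in
/-- The quotient `F_G / ⟨R_G⟩`, the target of the universal symmetric 2-cocycle on `G`. -/
abbrev CocycleGroup : Type u := FreeAbelianGroup (Sym2 G) ⧸ RG G

/-- The universal symmetric 2-cocycle on `G`. -/
def cocycleClass (g h : G) : CocycleGroup G := QuotientAddGroup.mk (of s(g, h))

theorem cocycleClass_comm (g h : G) : cocycleClass g h = cocycleClass h g := by
  rw [cocycleClass, Sym2.eq_swap, cocycleClass]

theorem cocycleClass_cocycle (g h k : G) :
    cocycleClass g h + cocycleClass (g * h) k = cocycleClass h k + cocycleClass g (h * k) := by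
  have : (QuotientAddGroup.mk (of s(g, h) + of s(g * h, k) - of s(h, k) - of s(g, h * k)) :
      CocycleGroup G) = 0 :=
    (QuotientAddGroup.eq_zero_iff _).2 (AddSubgroup.subset_closure ⟨g, h, k, rfl⟩)
  rw [← sub_eq_zero, ← this]
  simp only [cocycleClass, QuotientAddGroup.mk_add, QuotientAddGroup.mk_sub]
  abel

theorem cocycleClass_one_left (g : G) : cocycleClass 1 g = cocycleClass (1 : G) 1 := by
  have := cocycleClass_cocycle 1 1 g
  simp only [one_mul] at this
  exact (add_right_cancel this).symm

variable (G) in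
/-- The abelian extension of `G` by `F_G / ⟨R_G⟩` given by the universal symmetric 2-cocycle. -/
@[ext]
structure UniversalExtension : Type u where
  /-- The component in `F_G / ⟨R_G⟩`. -/
  fst : CocycleGroup G
  /-- The component in `G`. -/
  snd : G

namespace UniversalExtension

instance : Add (UniversalExtension G) :=
  ⟨fun x y => ⟨x.fst + y.fst + cocycleClass x.snd y.snd, x.snd * y.snd⟩⟩

instance : Zero (UniversalExtension G) := ⟨⟨-cocycleClass 1 1, 1⟩⟩

instance : Neg (UniversalExtension G) :=
  ⟨fun x => ⟨-x.fst - cocycleClass x.snd⁻¹ x.snd - cocycleClass 1 1, x.snd⁻¹⟩⟩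

@[simp] theorem fst_add (x y : UniversalExtension G) :
    (x + y).fst = x.fst + y.fst + cocycleClass x.snd y.snd := rfl
@[simp] theorem snd_add (x y : UniversalExtension G) : (x + y).snd = x.snd * y.snd := rfl
@[simp] theorem fst_zero : (0 : UniversalExtension G).fst = -cocycleClass 1 1 := rfl
@[simp] theorem snd_zero : (0 : UniversalExtension G).snd = 1 := rfl
@[simp] theorem fst_neg (x : UniversalExtension G) :
    (-x).fst = -x.fst - cocycleClass x.snd⁻¹ x.snd - cocycleClass 1 1 := rfl
@[simp] theorem snd_neg (x : UniversalExtension G) : (-x).snd = x.snd⁻¹ := rfl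

instance : AddCommGroup (UniversalExtension G) :=
  { AddGroup.ofLeftAxioms (G := UniversalExtension G)
      (fun x y z => by
        ext
        · have := cocycleClass_cocycle x.snd y.snd z.snd
          simp only [fst_add, snd_add]
          rw [show ∀ a b c d e : CocycleGroup G, a + b + c + d + e = a + b + d + (c + e) by
            intros; abel, this]
          abel
        · simp [mul_assoc])
      (fun x => by ext <;> simp [cocycleClass_one_left])
      (fun x => by
        ext
        · simp only [fst_add, snd_neg, fst_neg, fst_zero]
          abel
        · simp) with
    add_comm := fun x y => by
      ext
      · simp [cocycleClass_comm, add_comm]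
      · simp [mul_comm] }

/-- The inclusion of the kernel `F_G / ⟨R_G⟩` of the universal extension. -/
def inl : CocycleGroup G →+ UniversalExtension G where
  toFun q := ⟨q - cocycleClass 1 1, 1⟩
  map_zero' := by ext <;> simp
  map_add' p q := by
    ext
    · simp only [fst_add]
      abel
    · simp

theorem inl_injective : Function.Injective (inl (G := G)) := fun p q h => by
  simpa [inl] using congrArg fst h

/-- The set-theoretic section of the universal extension. -/
def inr (g : G) : UniversalExtension G := ⟨0, g⟩

theorem inr_add_inr (g h : G) : inr g + inr h = inl (cocycleClass g h) + inr (g * h) := by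
  ext
  · simp [inr, inl, cocycleClass_one_left]
  · simp [inr, inl]

end UniversalExtension

/-- Every symmetric 2-cocycle with values in `ℚ/ℤ` is a coboundary. -/
theorem exists_coboundaryHom_eq_character (c : CharacterModule (CocycleGroup G)) :
    ∃ β : G → AddCircle (1 : ℚ), ∀ w : FreeAbelianGroup (Sym2 G),
      c (QuotientAddGroup.mk w) = coboundaryHom β w := by
  obtain ⟨d, hd⟩ := CharacterModule.dual_surjective_of_injective
    (UniversalExtension.inl (G := G)).toIntLinearMap UniversalExtension.inl_injective c
  have hd' (q : CocycleGroup G) : c q = d (UniversalExtension.inl q) := by rw [← hd]; rfl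
  refine ⟨fun g => d (UniversalExtension.inr g), fun w => ?_⟩
  have : (d.comp UniversalExtension.inl).comp (QuotientAddGroup.mk' (RG G)) =
      coboundaryHom fun g => d (UniversalExtension.inr g) := by
    refine addMonoidHom_ext_sym2 fun g h => ?_
    rw [coboundaryHom_of, ← map_add, UniversalExtension.inr_add_inr, map_add, add_sub_cancel_right]
    rfl
  rw [hd', ← this]
  rfl

theorem mem_RG_of_coboundaryHom_of_eq_zero {w : FreeAbelianGroup (Sym2 G)}
    (hw : coboundaryHom (of : G → FreeAbelianGroup G) w = 0) : w ∈ RG G := by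
  rw [← QuotientAddGroup.eq_zero_iff]
  refine CharacterModule.eq_zero_of_character_apply fun c => ?_
  obtain ⟨β, hβ⟩ := exists_coboundaryHom_eq_character c
  rw [hβ, coboundaryHom_eq_lift_comp, AddMonoidHom.comp_apply, hw, map_zero]

theorem exists_unit_zpow_ne_one [Infinite F] {n : ℤ} (hn : n ≠ 0) : ∃ x : Fˣ, x ^ n ≠ 1 := by
  classical
  obtain ⟨y, hy⟩ := Infinite.exists_notMem_finset
    (insert 0 (Polynomial.nthRoots n.natAbs (1 : F)).toFinset)
  rw [Finset.mem_insert, Multiset.mem_toFinset,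
    Polynomial.mem_nthRoots (Int.natAbs_pos.2 hn), not_or] at hy
  refine ⟨Units.mk0 y hy.1, fun h => hy.2 ?_⟩
  simpa using congrArg Units.val (pow_natAbs_eq_one.2 h)

theorem mem_RG_iff_forall_coboundaryHom_units [Infinite F] {w : FreeAbelianGroup (Sym2 G)} :
    w ∈ RG G ↔ ∀ α : G → Fˣ, coboundaryHom (fun g => Additive.ofMul (α g)) w = 0 := by
  classical
  refine ⟨fun hw α => coboundaryHom_eq_zero_of_mem _ hw, fun H => ?_⟩
  refine mem_RG_of_coboundaryHom_of_eq_zero ?_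
  by_contra hne
  set v := coboundaryHom (of : G → FreeAbelianGroup G) w with hv
  obtain ⟨g, hg⟩ : ∃ g, FreeAbelianGroup.coeff g v ≠ 0 := by
    by_contra! h0
    refine hne ((FreeAbelianGroup.equivFinsupp G).injective ?_)
    ext g
    exact h0 g
  obtain ⟨x, hx⟩ := exists_unit_zpow_ne_one F hg
  have key : FreeAbelianGroup.lift (fun h => Additive.ofMul ((Pi.mulSingle g x : G → Fˣ) h)) =
      ((zmultiplesHom (Additive Fˣ)) (Additive.ofMul x)).comp (FreeAbelianGroup.coeff g) := by
    refine FreeAbelianGroup.lift_ext _ _ fun h => ?_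
    by_cases hgh : h = g
    · subst hgh
      simp [FreeAbelianGroup.coeff]
    · simp [FreeAbelianGroup.coeff, hgh]
  have := H (Pi.mulSingle g x)
  rw [coboundaryHom_eq_lift_comp, AddMonoidHom.comp_apply, key, ← hv, AddMonoidHom.comp_apply,
    zmultiplesHom_apply] at this
  exact hx this

/-- The character `α ↦ dα(w)` of the group of maps `G → F^×` attached to `w ∈ F_G`. -/
noncomputable def coboundaryChar (w : FreeAbelianGroup (Sym2 G)) : (G → Fˣ) →* F where
  toFun α := ((coboundaryHom (fun g => Additive.ofMul (α g)) w).toMul : Fˣ)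
  map_one' := by
    have : coboundaryHom (fun g : G => Additive.ofMul ((1 : G → Fˣ) g)) = 0 :=
      addMonoidHom_ext_sym2 fun g h => by simp
    rw [this]
    rfl
  map_mul' α γ := by
    have h : coboundaryHom (fun g => Additive.ofMul ((α * γ) g)) = _ :=
      coboundaryHom_add (fun g => Additive.ofMul (α g)) (fun g => Additive.ofMul (γ g))
    rw [h]
    simp

theorem coboundaryChar_add (w₁ w₂ : FreeAbelianGroup (Sym2 G)) :
    coboundaryChar F (w₁ + w₂) = coboundaryChar F w₁ * coboundaryChar F w₂ := by
  ext α
  simp [coboundaryChar]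

theorem coboundaryChar_zero : coboundaryChar F (0 : FreeAbelianGroup (Sym2 G)) = 1 := by
  ext α
  simp [coboundaryChar]

theorem coboundaryChar_of (i : Sym2 G) (α : G → Fˣ) : coboundaryChar F (of i) α = dal F α i := by
  induction i with
  | h g h => simp [coboundaryChar, dal, div_eq_mul_inv]

theorem coboundaryChar_eq_iff [Infinite F] {w₁ w₂ : FreeAbelianGroup (Sym2 G)} :
    coboundaryChar F w₁ = coboundaryChar F w₂ ↔ w₁ - w₂ ∈ RG G := by
  rw [mem_RG_iff_forall_coboundaryHom_units F, DFunLike.ext_iff]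
  refine forall_congr' fun α => ?_
  rw [map_sub, sub_eq_zero]
  exact Units.val_inj.trans Additive.toMul.injective.eq_iff

set_option linter.unusedSectionVars false in
theorem rOf_mem_FS (S : Set (Sym2 G)) (m : ↥S →₀ ℕ) : rOf S m ∈ FS S :=
  AddSubgroup.sum_mem _ fun i _ =>
    AddSubgroup.nsmul_mem _ (AddSubgroup.subset_closure (Set.mem_image_of_mem _ i.2)) _

set_option linter.unusedSectionVars false in
theorem epow_ne_zero (S : Set (Sym2 G)) (ε : ↥S → Fˣ) (m : ↥S →₀ ℕ) : epow F S ε m ≠ 0 :=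
  Finset.prod_ne_zero_iff.2 fun i _ => pow_ne_zero _ (ε i).ne_zero

theorem coboundaryChar_rOf (S : Set (Sym2 G)) (m : ↥S →₀ ℕ) (α : G → Fˣ) :
    coboundaryChar F (rOf S m) α = m.prod fun i n => dal F α ↑i ^ n := by
  let φ : Multiplicative (FreeAbelianGroup (Sym2 G)) →* F :=
    { toFun := fun w => coboundaryChar F w.toAdd α
      map_one' := by simp [coboundaryChar_zero]
      map_mul' := fun a b => by simp [coboundaryChar_add] }
  have : φ (Multiplicative.ofAdd (rOf S m)) = m.prod fun i n => dal F α ↑i ^ n := by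
    rw [rOf, Finsupp.sum, ofAdd_sum, map_prod, Finsupp.prod]
    refine Finset.prod_congr rfl fun i _ => ?_
    rw [ofAdd_nsmul, map_pow]
    exact congrArg (· ^ m i) (coboundaryChar_of F _ α)
  exact this

theorem eval_monomial_orbit (S : Set (Sym2 G)) (ε : ↥S → Fˣ) (α : G → Fˣ) (m : ↥S →₀ ℕ) (a : F) :
    MvPolynomial.eval (fun i : ↥S => dal F α ↑i * (ε i : F)) (MvPolynomial.monomial m a) =
      a * (epow F S ε m * coboundaryChar F (rOf S m) α) := by
  rw [MvPolynomial.eval_monomial, coboundaryChar_rOf, epow, ← Finsupp.prod_mul]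
  simp only [mul_pow, mul_comm]

theorem vanishing_ideal_of_orbit_closure [IsAlgClosed F]
    (S : Set (Sym2 G)) (hS : S.Finite) (ε : ↥S → Fˣ) (f : MvPolynomial ↥S F) :
    (∀ α : G → Fˣ,
      MvPolynomial.eval (fun i : ↥S => dal F α ↑i * (ε i : F)) f = 0) ↔
    f ∈ Submodule.span F
      {p : MvPolynomial ↥S F | ∃ m₁ m₂ : ↥S →₀ ℕ,
        (rOf S m₁ - rOf S m₂ ∈ RG G ⊓ FS S) ∧
        p = MvPolynomial.monomial m₁ (epow F S ε m₂) -
            MvPolynomial.monomial m₂ (epow F S ε m₁)} := by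
  classical
  set W := Submodule.span F
      {p : MvPolynomial ↥S F | ∃ m₁ m₂ : ↥S →₀ ℕ,
        (rOf S m₁ - rOf S m₂ ∈ RG G ⊓ FS S) ∧
        p = MvPolynomial.monomial m₁ (epow F S ε m₂) -
            MvPolynomial.monomial m₂ (epow F S ε m₁)} with hW
  constructor
  · intro H
    -- `T` sorts the terms of a polynomial by the character they induce on the orbit.
    let T : MvPolynomial ↥S F →ₗ[F] (((G → Fˣ) →* F) →₀ F) :=
      (MvPolynomial.basisMonomials ↥S F).constr F fun m =>
        Finsupp.single (coboundaryChar F (rOf S m)) (epow F S ε m)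
    have hT (m : ↥S →₀ ℕ) (a : F) : T (MvPolynomial.monomial m a) =
        Finsupp.single (coboundaryChar F (rOf S m)) (a * epow F S ε m) := by
      have h1 : T (MvPolynomial.monomial m 1) =
          Finsupp.single (coboundaryChar F (rOf S m)) (epow F S ε m) := by
        have := (MvPolynomial.basisMonomials ↥S F).constr_basis F
          (fun m => Finsupp.single (coboundaryChar F (rOf S m)) (epow F S ε m)) m
        rwa [MvPolynomial.coe_basisMonomials] at this
      rw [← mul_one a, ← smul_eq_mul a 1, ← MvPolynomial.smul_monomial, map_smul, h1]
      simp
    have hTeval (p : MvPolynomial ↥S F) (α : G → Fˣ) :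
        Finsupp.linearCombination F (fun χ : (G → Fˣ) →* F => (χ : (G → Fˣ) → F)) (T p) α =
          MvPolynomial.eval (fun i : ↥S => dal F α ↑i * (ε i : F)) p := by
      induction p using MvPolynomial.induction_on' with
      | monomial m a =>
        rw [eval_monomial_orbit, hT, Finsupp.linearCombination_single]
        simp [mul_assoc]
      | add p q hp hq => rw [map_add, map_add, map_add, Pi.add_apply, hp, hq]
    have hTf : T f = 0 := by
      refine linearIndependent_iff.1 (linearIndependent_monoidHom (G → Fˣ) F) _ ?_
      funext α
      rw [hTeval, H α, Pi.zero_apply]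
    -- `Y` picks a normalized monomial representing each character.
    let Y (χ : (G → Fˣ) →* F) : MvPolynomial ↥S F :=
      if h : ∃ m : ↥S →₀ ℕ, coboundaryChar F (rOf S m) = χ then
        MvPolynomial.monomial h.choose (epow F S ε h.choose)⁻¹ else 0
    have hY (p : MvPolynomial ↥S F) : p - Finsupp.linearCombination F Y (T p) ∈ W := by
      induction p using MvPolynomial.induction_on' with
      | monomial m a =>
        have h : ∃ m' : ↥S →₀ ℕ, coboundaryChar F (rOf S m') = coboundaryChar F (rOf S m) :=
          ⟨m, rfl⟩
        rw [hT, Finsupp.linearCombination_single]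
        simp only [Y, dif_pos h]
        have hχ := h.choose_spec
        generalize h.choose = m' at hχ ⊢
        have hmem : MvPolynomial.monomial m (epow F S ε m') -
            MvPolynomial.monomial m' (epow F S ε m) ∈ W :=
          Submodule.subset_span ⟨m, m', ⟨(coboundaryChar_eq_iff F).1 hχ.symm,
            AddSubgroup.sub_mem _ (rOf_mem_FS S m) (rOf_mem_FS S m')⟩, rfl⟩
        convert W.smul_mem (a * (epow F S ε m')⁻¹) hmem using 1
        rw [smul_sub, MvPolynomial.smul_monomial, MvPolynomial.smul_monomial,
          MvPolynomial.smul_monomial]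
        simp only [smul_eq_mul]
        rw [inv_mul_cancel_right₀ (epow_ne_zero F S ε m'), mul_right_comm]
      | add p q hp hq =>
        rw [map_add, map_add, add_sub_add_comm]
        exact W.add_mem hp hq
    simpa [hTf] using hY f
  · intro hf α
    have hle : W ≤ LinearMap.ker
        (MvPolynomial.aeval (R := F) fun i : ↥S => dal F α ↑i * (ε i : F)).toLinearMap := by
      rw [hW, Submodule.span_le]
      rintro _ ⟨m₁, m₂, ⟨h, -⟩, rfl⟩
      rw [SetLike.mem_coe, LinearMap.mem_ker, AlgHom.toLinearMap_apply, MvPolynomial.aeval_eq_eval,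
        map_sub, eval_monomial_orbit, eval_monomial_orbit,
        (coboundaryChar_eq_iff F).2 h]
      ring
    simpa [MvPolynomial.aeval_eq_eval] using hle hf
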